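/- Let n ≥ 2, p ∈ ℝ, δ ∈ (0,1/8), R > 0, let Ω ⊂ ℝⁿ be a bounded (δ,R)-Reifenberg flat domain, let T ∈ ℝ, and set Ω_𝔗 := Ω × (−∞, T). Let 0 < ε < 1, let λ > 0, and let 𝔠 ⊂ 𝔡 be two bounded measurable subsets of Ω_𝔗 such that: (i) |𝔠| < ε |Q_{R/10}^λ|, where |Q_r^λ| := 2 λ^{2−p} r² |B_r| denotes the Lebesgue measure of an intrinsic cylinder of radius r; and (ii) for every (x,t) ∈ Ω_𝔗 and every r ∈ (0, R/10] with |𝔠 ∩ Q_r^λ(x,t)| ≥ ε |Q_r^λ|, one has Q_r^λ(x,t) ∩ Ω_𝔗 ⊂ 𝔡. Then |𝔠| ≤ (10/(1−δ))^{n+2} ε |𝔡| ≤ (80/7)^{n+2} ε |𝔡|. -/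

import Mathlib

open MeasureTheory Set Metric
open scoped ENNReal

noncomputable section

/-- The intrinsic parabolic cylinder `Q_r^λ(x,t) = B_r(x) × (t − λ^{2−p} r², t + λ^{2−p} r²)`. -/
def icyl (n : ℕ) (p lam r : ℝ) (x : EuclideanSpace ℝ (Fin n)) (t : ℝ) :
    Set (EuclideanSpace ℝ (Fin n) × ℝ) :=
  ball x r ×ˢ Ioo (t - lam ^ (2 - p) * r ^ 2) (t + lam ^ (2 - p) * r ^ 2)

/-- A bounded domain `Ω ⊆ ℝⁿ` is `(δ,R)`-Reifenberg flat. -/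
def ReifenbergFlat {n : ℕ} (hn : 0 < n) (Ω : Set (EuclideanSpace ℝ (Fin n))) (δ R : ℝ) : Prop :=
  ∀ y₀ ∈ frontier Ω, ∀ r ∈ Set.Ioc (0 : ℝ) R,
    ∃ φ : EuclideanSpace ℝ (Fin n) ≃ᵢ EuclideanSpace ℝ (Fin n),
      φ y₀ = 0 ∧
      ball (0 : EuclideanSpace ℝ (Fin n)) r ∩
          {y | δ * r < y ⟨n - 1, Nat.sub_lt hn one_pos⟩} ⊆
        ball (0 : EuclideanSpace ℝ (Fin n)) r ∩ (φ '' Ω) ∧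
      ball (0 : EuclideanSpace ℝ (Fin n)) r ∩ (φ '' Ω) ⊆
        ball (0 : EuclideanSpace ℝ (Fin n)) r ∩
          {y | -(δ * r) < y ⟨n - 1, Nat.sub_lt hn one_pos⟩}

open Topology

theorem isOpen_icyl (n : ℕ) (p lam r : ℝ) (x : EuclideanSpace ℝ (Fin n)) (t : ℝ) :
    IsOpen (icyl n p lam r x t) :=
  isOpen_ball.prod isOpen_Ioo

theorem mem_icyl_self {n : ℕ} {p lam r : ℝ} (hlam : 0 < lam) (hr : 0 < r)
    (x : EuclideanSpace ℝ (Fin n)) (t : ℝ) : (x, t) ∈ icyl n p lam r x t := by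
  have h : 0 < lam ^ (2 - p) * r ^ 2 := by positivity
  exact ⟨mem_ball_self hr, by simp only [mem_Ioo]; constructor <;> linarith⟩

theorem icyl_mono {n : ℕ} {p lam r s : ℝ} (hlam : 0 < lam) (hr : 0 ≤ r) (hrs : r ≤ s)
    (x : EuclideanSpace ℝ (Fin n)) (t : ℝ) : icyl n p lam r x t ⊆ icyl n p lam s x t := by
  have h : lam ^ (2 - p) * r ^ 2 ≤ lam ^ (2 - p) * s ^ 2 := by gcongr
  exact prod_mono (ball_subset_ball hrs) (Ioo_subset_Ioo (by linarith) (by linarith))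

theorem volume_icyl (n : ℕ) (p lam r : ℝ) (x : EuclideanSpace ℝ (Fin n)) (t : ℝ) :
    volume (icyl n p lam r x t) =
      volume (ball x r) * ENNReal.ofReal (2 * (lam ^ (2 - p) * r ^ 2)) := by
  rw [icyl, Measure.volume_eq_prod, Measure.prod_prod, Real.volume_Ioo]
  congr 2
  ring

theorem volume_icyl_center (n : ℕ) (p lam r : ℝ) (x : EuclideanSpace ℝ (Fin n)) (t : ℝ) :
    volume (icyl n p lam r x t) = volume (icyl n p lam r 0 0) := by
  rw [volume_icyl, volume_icyl, Measure.addHaar_ball_center]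

theorem volume_icyl_ne_top (n : ℕ) (p lam r : ℝ) (x : EuclideanSpace ℝ (Fin n)) (t : ℝ) :
    volume (icyl n p lam r x t) ≠ ∞ := by
  rw [volume_icyl]
  exact ENNReal.mul_ne_top measure_ball_lt_top.ne ENNReal.ofReal_ne_top

theorem volume_icyl_mul {n : ℕ} {p lam : ℝ} {c : ℝ} (hc : 0 < c) (r : ℝ)
    (x : EuclideanSpace ℝ (Fin n)) (t : ℝ) :
    volume (icyl n p lam (c * r) x t) =
      ENNReal.ofReal (c ^ (n + 2)) * volume (icyl n p lam r x t) := by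
  rw [volume_icyl, volume_icyl, Measure.addHaar_ball_mul_of_pos _ _ hc, finrank_euclideanSpace_fin,
    Measure.addHaar_ball_center volume x r,
    show 2 * (lam ^ (2 - p) * (c * r) ^ 2) = c ^ 2 * (2 * (lam ^ (2 - p) * r ^ 2)) by ring,
    ENNReal.ofReal_mul (p := c ^ 2) (by positivity), pow_add,
    ENNReal.ofReal_mul (p := c ^ n) (by positivity)]
  ring

/-- Vitali covering by intrinsic cylinders of varying, bounded radii. -/
theorem exists_disjoint_icyl_covering {n : ℕ} {p lam : ℝ} (hlam : 0 < lam)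
    (A : Set (EuclideanSpace ℝ (Fin n) × ℝ)) (ρ : EuclideanSpace ℝ (Fin n) × ℝ → ℝ) (M : ℝ)
    (hρ : ∀ a ∈ A, ρ a ∈ Ioc 0 M) :
    ∃ u ⊆ A, u.Countable ∧ u.PairwiseDisjoint (fun a => icyl n p lam (ρ a) a.1 a.2) ∧
      A ⊆ ⋃ b ∈ u, icyl n p lam (5 * ρ b) b.1 b.2 := by
  have hne : ∀ a ∈ A, (icyl n p lam (ρ a) a.1 a.2).Nonempty := fun a ha =>
    ⟨a, mem_icyl_self hlam (hρ a ha).1 a.1 a.2⟩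
  obtain ⟨u, huA, hud, hcov⟩ := Vitali.exists_disjoint_subfamily_covering_enlargement
    (fun a => icyl n p lam (ρ a) a.1 a.2) A ρ 2 one_lt_two (fun a ha => (hρ a ha).1.le) M
    (fun a ha => (hρ a ha).2) hne
  refine ⟨u, huA, hud.countable_of_isOpen (fun a _ => isOpen_icyl ..)
    (fun a ha => hne a (huA ha)), hud, fun a ha => ?_⟩
  obtain ⟨b, hb, ⟨y, ⟨hya, hta⟩, ⟨hyb, htb⟩⟩, hab⟩ := hcov a ha
  have ha0 := (hρ a ha).1
  have hb0 := (hρ b (huA hb)).1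
  refine mem_iUnion₂.2 ⟨b, hb, ?_, ?_⟩
  · rw [mem_ball] at hya hyb ⊢
    linarith [dist_triangle_left a.1 b.1 y.1]
  · have hk : 0 < lam ^ (2 - p) := by positivity
    have h1 : lam ^ (2 - p) * ρ a ^ 2 ≤ lam ^ (2 - p) * (2 * ρ b) ^ 2 := by gcongr
    have h2 : 0 < lam ^ (2 - p) * ρ b ^ 2 := by positivity
    rw [mem_Ioo] at hta htb ⊢
    constructor <;> nlinarith

theorem exists_icyl_subset_of_mem_nhds {n : ℕ} {p lam : ℝ}
    {U : Set (EuclideanSpace ℝ (Fin n) × ℝ)} {a : EuclideanSpace ℝ (Fin n) × ℝ} (hU : U ∈ 𝓝 a)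
    {M : ℝ} (hM : 0 < M) : ∃ r ∈ Ioc 0 M, icyl n p lam r a.1 a.2 ⊆ U := by
  obtain ⟨η, hη, hball⟩ := Metric.mem_nhds_iff.1 hU
  have hlim : Filter.Tendsto (fun r : ℝ => lam ^ (2 - p) * r ^ 2) (𝓝[>] 0) (𝓝 0) := by
    have : Continuous fun r : ℝ => lam ^ (2 - p) * r ^ 2 := by fun_prop
    simpa using (this.tendsto 0).mono_left nhdsWithin_le_nhds
  have hev : ∀ᶠ r : ℝ in 𝓝[>] 0, r ∈ Ioc 0 (min M η) :=
    Ioc_mem_nhdsGT (lt_min hM hη)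
  obtain ⟨r, hr, hr'⟩ := (hev.and (hlim.eventually_lt_const hη)).exists
  refine ⟨r, ⟨hr.1, hr.2.trans (min_le_left _ _)⟩, fun y hy => hball ?_⟩
  obtain ⟨h1, h2⟩ := hy
  rw [mem_ball] at h1
  rw [mem_Ioo] at h2
  rw [mem_ball, Prod.dist_eq, max_lt_iff, Real.dist_eq, abs_lt]
  exact ⟨h1.trans_le (hr.2.trans (min_le_right _ _)), by linarith, by linarith⟩

/-- A set whose density in all small centered intrinsic cylinders is at most `ε < 1` is null. -/
theorem volume_eq_zero_of_density_le {n : ℕ} {p lam ε M : ℝ} (hlam : 0 < lam) (hε : 0 < ε)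
    (hε1 : ε < 1) (hM : 0 < M) (N : Set (EuclideanSpace ℝ (Fin n) × ℝ)) (hN : volume N ≠ ∞)
    (hdens : ∀ a ∈ N, ∀ r ∈ Ioc 0 M, volume (N ∩ icyl n p lam r a.1 a.2) ≤
      ENNReal.ofReal ε * volume (icyl n p lam r a.1 a.2)) : volume N = 0 := by
  by_contra h0
  have hm : 0 < (volume N).toReal := ENNReal.toReal_pos h0 hN
  set m := (volume N).toReal with hmdef
  have hη : 0 < (1 - ε) * m / (2 * 5 ^ (n + 2)) := by
    have : 0 < 1 - ε := by linarith
    positivity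
  set η := (1 - ε) * m / (2 * 5 ^ (n + 2)) with hηdef
  obtain ⟨U, hNU, hUo, hU⟩ := N.exists_isOpen_lt_add hN (ENNReal.ofReal_pos.2 hη).ne'
  have hUtop : volume U ≠ ∞ := hU.ne_top
  have hr : ∀ a ∈ N, ∃ r ∈ Ioc 0 M, icyl n p lam r a.1 a.2 ⊆ U := fun a ha =>
    exists_icyl_subset_of_mem_nhds (hUo.mem_nhds (hNU ha)) hM
  choose! ρ hρ hρU using hr
  obtain ⟨u, huN, huc, hud, hcov⟩ := exists_disjoint_icyl_covering (p := p) hlam N ρ M hρ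
  set W := ⋃ b ∈ u, icyl n p lam (ρ b) b.1 b.2 with hW
  have hWU : W ⊆ U := iUnion₂_subset fun b hb => hρU b (huN hb)
  have hWm : MeasurableSet W :=
    (isOpen_biUnion fun b _ => isOpen_icyl ..).measurableSet
  have hWvol : volume W = ∑' b : u, volume (icyl n p lam (ρ b) b.1.1 b.1.2) :=
    measure_biUnion huc hud fun b _ => (isOpen_icyl ..).measurableSet
  have hWtop : volume W ≠ ∞ := measure_ne_top_of_subset hWU hUtop
  have hA : volume N ≤ ENNReal.ofReal (5 ^ (n + 2)) * volume W := by
    calc volume N ≤ ∑' b : u, volume (icyl n p lam (5 * ρ b) b.1.1 b.1.2) :=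
          (measure_mono hcov).trans (measure_biUnion_le _ huc _)
      _ = _ := by
          rw [hWvol, ← ENNReal.tsum_mul_left]
          exact tsum_congr fun b => volume_icyl_mul (by norm_num) ..
  have hB : volume (N ∩ W) ≤ ENNReal.ofReal ε * volume W := by
    calc volume (N ∩ W) ≤ ∑' b : u, volume (N ∩ icyl n p lam (ρ b) b.1.1 b.1.2) := by
          rw [hW, inter_iUnion₂]
          exact measure_biUnion_le _ huc _
      _ ≤ _ := by
          rw [hWvol, ← ENNReal.tsum_mul_left]
          exact ENNReal.tsum_le_tsum fun b => hdens b (huN b.2) _ (hρ b (huN b.2))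
  have hD : volume (N \ W) + volume W ≤ volume U := by
    calc volume (N \ W) + volume W ≤ volume (U \ W) + volume W := by gcongr
      _ = volume U := by rw [add_comm, measure_add_sdiff hWm.nullMeasurableSet,
          union_eq_right.2 hWU]
  have hE : volume N ≤ volume (N ∩ W) + volume (N \ W) := measure_le_inter_add_sdiff _ _ _
  have hF : volume N + volume W ≤ ENNReal.ofReal ε * volume W + (volume N + ENNReal.ofReal η) := by
    calc volume N + volume W ≤ volume (N ∩ W) + (volume (N \ W) + volume W) := by
          rw [← add_assoc]; gcongr
      _ ≤ _ := add_le_add hB (hD.trans hU.le)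
  have hA' : m ≤ 5 ^ (n + 2) * (volume W).toReal := by
    have := ENNReal.toReal_mono (ENNReal.mul_ne_top ENNReal.ofReal_ne_top hWtop) hA
    rwa [ENNReal.toReal_mul, ENNReal.toReal_ofReal (by positivity)] at this
  have hF' : m + (volume W).toReal ≤ ε * (volume W).toReal + (m + η) := by
    have h3 := ENNReal.mul_ne_top (ENNReal.ofReal_ne_top (r := ε)) hWtop
    have h4 : volume N + ENNReal.ofReal η ≠ ∞ := ENNReal.add_ne_top.2 ⟨hN, ENNReal.ofReal_ne_top⟩
    have := ENNReal.toReal_mono (ENNReal.add_ne_top.2 ⟨h3, h4⟩) hF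
    rwa [ENNReal.toReal_add hN hWtop, ENNReal.toReal_add h3 h4,
      ENNReal.toReal_add hN ENNReal.ofReal_ne_top, ENNReal.toReal_mul,
      ENNReal.toReal_ofReal hε.le, ENNReal.toReal_ofReal hη.le] at this
  have hη2 : η * (2 * 5 ^ (n + 2)) = (1 - ε) * m := by rw [hηdef]; field_simp
  have h5 : (0 : ℝ) < 5 ^ (n + 2) := by positivity
  have h6 : (1 - ε) * m ≤ (1 - ε) * (5 ^ (n + 2) * (volume W).toReal) :=
    mul_le_mul_of_nonneg_left hA' (by linarith)
  have h7 : 5 ^ (n + 2) * ((1 - ε) * (volume W).toReal) ≤ 5 ^ (n + 2) * η :=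
    mul_le_mul_of_nonneg_left (by linarith) h5.le
  nlinarith

/-- At least half of a ball lies on one side of a hyperplane through its center. -/
theorem volume_ball_le_two_mul_halfBall {n : ℕ} {f : EuclideanSpace ℝ (Fin n) → ℝ}
    {z : EuclideanSpace ℝ (Fin n)} (hf : ∀ w, f (z + z - w) = f z + f z - f w) (s : ℝ) :
    volume (ball z s) ≤ 2 * volume (ball z s ∩ {w | f z ≤ f w}) := by
  have hpre : (fun w => z + z - w) ⁻¹' (ball z s ∩ {w | f w ≤ f z}) =
      ball z s ∩ {w | f z ≤ f w} := by
    ext w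
    have : dist (z + z - w) z = dist w z := by
      rw [dist_eq_norm, dist_eq_norm, ← norm_neg]; congr 1; abel
    simp only [mem_preimage, mem_inter_iff, mem_ball, mem_ofPred_eq, this, hf]
    constructor <;> rintro ⟨h1, h2⟩ <;> exact ⟨h1, by linarith⟩
  have heq : volume (ball z s ∩ {w | f w ≤ f z}) = volume (ball z s ∩ {w | f z ≤ f w}) := by
    rw [← hpre]
    exact ((Measure.measurePreserving_sub_left volume (z + z)).measure_preimage_equiv
      (f := MeasurableEquiv.subLeft (z + z)) _).symm
  calc volume (ball z s)
      ≤ volume ((ball z s ∩ {w | f z ≤ f w}) ∪ (ball z s ∩ {w | f w ≤ f z})) :=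
        measure_mono fun w hw => (le_total (f z) (f w)).imp (⟨hw, ·⟩) (⟨hw, ·⟩)
    _ ≤ _ := (measure_union_le _ _).trans (by rw [heq, two_mul])

theorem IsometryEquiv.map_add_self_sub {E : Type*} [NormedAddCommGroup E] [NormedSpace ℝ E]
    (φ : E ≃ᵢ E) (z w : E) : φ (z + z - w) = φ z + φ z - φ w := by
  have h : ∀ v, φ v = φ.toRealLinearIsometryEquiv v + φ 0 := fun v => by
    simp
  rw [h, h z, h w, map_sub, map_add]
  abel

theorem subset_of_isPreconnected_of_disjoint_frontier {X : Type*} [TopologicalSpace X]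
    {s U : Set X} (hs : IsPreconnected s) (hU : IsOpen U) (hne : (s ∩ U).Nonempty)
    (hd : Disjoint s (frontier U)) : s ⊆ U := by
  refine hs.subset_left_of_subset_union hU isClosed_closure.isOpen_compl
    (disjoint_compl_right.mono_left subset_closure) (fun y hy => ?_) hne
  by_contra h
  simp only [mem_union, mem_compl_iff, not_or, not_not] at h
  exact hd.le_bot ⟨hy, by rw [hU.frontier_eq]; exact ⟨h.2, h.1⟩⟩

/-- Interior measure density of a Reifenberg flat open set. -/
theorem ReifenbergFlat.volume_ball_le {n : ℕ} {hn : 0 < n} {Ω : Set (EuclideanSpace ℝ (Fin n))}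
    {δ R : ℝ} (hRF : ReifenbergFlat hn Ω δ R) (hδ : δ ∈ Ioo (0 : ℝ) (1 / 8)) (hΩ : IsOpen Ω)
    {x : EuclideanSpace ℝ (Fin n)} (hx : x ∈ Ω) {r : ℝ} (hr : 0 < r) (hrR : 2 * r ≤ R) :
    ENNReal.ofReal (((1 - δ) / 2) ^ n) * volume (ball x r) ≤ 2 * volume (ball x r ∩ Ω) := by
  obtain ⟨hδ0, hδ1⟩ := hδ
  have hc : 0 < (1 - δ) / 2 := by linarith
  by_cases hfr : Disjoint (ball x r) (frontier Ω)
  · have hsub : ball x r ⊆ Ω := subset_of_isPreconnected_of_disjoint_frontier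
      (convex_ball x r).isPreconnected hΩ ⟨x, mem_ball_self hr, hx⟩ hfr
    rw [inter_eq_left.2 hsub]
    gcongr
    calc ENNReal.ofReal (((1 - δ) / 2) ^ n) ≤ 1 :=
          ENNReal.ofReal_le_one.2 (pow_le_one₀ hc.le (by linarith))
      _ ≤ 2 := one_le_two
  · obtain ⟨y₀, hy₀r, hy₀⟩ := not_disjoint_iff.1 hfr
    obtain ⟨φ, hφ0, hup, hlow⟩ := hRF y₀ hy₀ (2 * r) ⟨by linarith, hrR⟩
    set i : Fin n := ⟨n - 1, Nat.sub_lt hn one_pos⟩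
    have hmem : ∀ y ∈ ball x r, φ y ∈ ball (0 : EuclideanSpace ℝ (Fin n)) (2 * r) := by
      intro y hy
      rw [mem_ball] at hy hy₀r ⊢
      rw [← hφ0, φ.dist_eq]
      linarith [dist_triangle_right y y₀ x]
    have hxlow : -(δ * (2 * r)) < φ x i :=
      (hlow ⟨hmem x (mem_ball_self hr), mem_image_of_mem φ hx⟩).2
    set z := φ.symm (φ x + EuclideanSpace.single i (4 * δ * r)) with hz
    have hφz : φ z = φ x + EuclideanSpace.single i (4 * δ * r) := φ.apply_symm_apply _
    have hzi : φ z i = φ x i + 4 * δ * r := by rw [hφz]; simp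
    have hzx : dist z x = 4 * δ * r := by
      rw [← φ.dist_eq, hφz, dist_eq_norm, add_sub_cancel_left, PiLp.norm_single,
        Real.norm_of_nonneg (by positivity)]
    have hballs : ball z ((1 - δ) / 2 * r) ⊆ ball x r :=
      ball_subset_ball' (by rw [hzx]; nlinarith)
    have hsub : ball z ((1 - δ) / 2 * r) ∩ {w | φ z i ≤ φ w i} ⊆ ball x r ∩ Ω := by
      rintro w ⟨hw, hwi⟩
      refine ⟨hballs hw, ?_⟩
      have hwi' : φ z i ≤ φ w i := hwi
      have : φ w ∈ φ '' Ω := (hup ⟨hmem w (hballs hw), by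
        simp only [mem_ofPred_eq]; linarith⟩).2
      exact φ.injective.mem_set_image.1 this
    calc ENNReal.ofReal (((1 - δ) / 2) ^ n) * volume (ball x r)
        = volume (ball z ((1 - δ) / 2 * r)) := by
          rw [Measure.addHaar_ball_mul_of_pos _ _ hc, finrank_euclideanSpace_fin,
            Measure.addHaar_ball_center volume x r]
      _ ≤ 2 * volume (ball z ((1 - δ) / 2 * r) ∩ {w | φ z i ≤ φ w i}) :=
          volume_ball_le_two_mul_halfBall (f := fun w => φ w i)
            (fun w => by simp [φ.map_add_self_sub]) _
      _ ≤ _ := by gcongr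

theorem ReifenbergFlat.volume_icyl_le {n : ℕ} {hn : 0 < n} {Ω : Set (EuclideanSpace ℝ (Fin n))}
    {δ R : ℝ} (hRF : ReifenbergFlat hn Ω δ R) (hδ : δ ∈ Ioo (0 : ℝ) (1 / 8)) (hΩ : IsOpen Ω)
    {p lam : ℝ} (hlam : 0 < lam) {x : EuclideanSpace ℝ (Fin n)} (hx : x ∈ Ω) {t T : ℝ}
    (ht : t < T) {r : ℝ} (hr : 0 < r) (hrR : 2 * r ≤ R) :
    volume (icyl n p lam r x t) ≤
      ENNReal.ofReal ((2 / (1 - δ)) ^ (n + 2)) * volume (icyl n p lam r x t ∩ Ω ×ˢ Iio T) := by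
  have hball := hRF.volume_ball_le hδ hΩ hx hr hrR
  obtain ⟨hδ0, hδ1⟩ := hδ
  have h1δ : 0 < 1 - δ := by linarith
  set k := lam ^ (2 - p) * r ^ 2 with hk
  have hk0 : 0 < k := by positivity
  have hsub : (ball x r ∩ Ω) ×ˢ Ioo (t - k) t ⊆ icyl n p lam r x t ∩ Ω ×ˢ Iio T := by
    rintro ⟨y, s⟩ ⟨⟨hy, hyΩ⟩, hs1, hs2⟩
    simp only at hy hyΩ hs1 hs2
    exact ⟨⟨hy, hs1, by simp only; linarith⟩, hyΩ, hs2.trans ht⟩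
  have hvol : volume (ball x r ∩ Ω) * ENNReal.ofReal k ≤
      volume (icyl n p lam r x t ∩ Ω ×ˢ Iio T) := by
    refine le_trans (le_of_eq ?_) (measure_mono hsub)
    rw [Measure.volume_eq_prod, Measure.prod_prod, Real.volume_Ioo, sub_sub_cancel]
  have hinv : ENNReal.ofReal ((2 / (1 - δ)) ^ n) * ENNReal.ofReal (((1 - δ) / 2) ^ n) = 1 := by
    rw [← ENNReal.ofReal_mul (by positivity), ← mul_pow, div_mul_div_cancel₀ h1δ.ne']
    simp
  have h4 : (4 : ℝ≥0∞) ≤ ENNReal.ofReal ((2 / (1 - δ)) ^ 2) := by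
    rw [show (4 : ℝ≥0∞) = ENNReal.ofReal 4 by simp]
    apply ENNReal.ofReal_le_ofReal
    rw [div_pow, le_div_iff₀ (by positivity)]
    nlinarith
  calc volume (icyl n p lam r x t)
      = ENNReal.ofReal ((2 / (1 - δ)) ^ n) *
          (ENNReal.ofReal (((1 - δ) / 2) ^ n) * volume (ball x r)) * (2 * ENNReal.ofReal k) := by
        rw [← mul_assoc (ENNReal.ofReal ((2 / (1 - δ)) ^ n)), hinv, one_mul, volume_icyl, ← hk, ENNReal.ofReal_mul zero_le_two]
        simp
    _ ≤ ENNReal.ofReal ((2 / (1 - δ)) ^ n) *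
          (2 * volume (ball x r ∩ Ω)) * (2 * ENNReal.ofReal k) := by gcongr
    _ = ENNReal.ofReal ((2 / (1 - δ)) ^ n) * 4 * (volume (ball x r ∩ Ω) * ENNReal.ofReal k) := by
        ring
    _ ≤ ENNReal.ofReal ((2 / (1 - δ)) ^ n) * ENNReal.ofReal ((2 / (1 - δ)) ^ 2) *
          volume (icyl n p lam r x t ∩ Ω ×ˢ Iio T) := by gcongr
    _ = _ := by rw [← ENNReal.ofReal_mul (by positivity), ← pow_add]

theorem exists_mem_five_mul_notMem {S : Set ℝ} {M : ℝ} (hS : S ⊆ Ioc 0 M) (hne : S.Nonempty) :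
    ∃ r ∈ S, 5 * r ∉ S := by
  by_contra! h
  obtain ⟨r, hr⟩ := hne
  have hpow : ∀ k : ℕ, 5 ^ k * r ∈ S := by
    intro k
    induction k with
    | zero => simpa using hr
    | succ k ih => rw [pow_succ', mul_assoc]; exact h _ ih
  obtain ⟨k, hk⟩ := pow_unbounded_of_one_lt (M / r) (by norm_num : (1 : ℝ) < 5)
  rw [div_lt_iff₀ (hS hr).1] at hk
  exact hk.not_ge (hS (hpow k)).2

/-- Vitali-type covering lemma on intrinsic parabolic cylinders over `Ω_𝔗 = Ω × (−∞,T)`.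
Here `|Q_r^λ|` is realized as the volume of the intrinsic cylinder centered at the origin. -/
theorem stmt7 (n : ℕ) (hn : 2 ≤ n) (p : ℝ) (δ R : ℝ) (hδ : δ ∈ Ioo (0 : ℝ) (1 / 8))
    (hR : 0 < R) (Ω : Set (EuclideanSpace ℝ (Fin n)))
    (hΩo : IsOpen Ω) (hΩc : IsConnected Ω) (hΩb : Bornology.IsBounded Ω)
    (hRF : ReifenbergFlat (show 0 < n by omega) Ω δ R) (T : ℝ)
    (ε : ℝ) (hε : 0 < ε) (hε1 : ε < 1) (lam : ℝ) (hlam : 0 < lam)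
    (C D : Set (EuclideanSpace ℝ (Fin n) × ℝ))
    (hCD : C ⊆ D) (hD : D ⊆ Ω ×ˢ Iio T)
    (hCm : MeasurableSet C) (hDm : MeasurableSet D)
    (hCb : Bornology.IsBounded C) (hDb : Bornology.IsBounded D)
    (h1 : volume C < ENNReal.ofReal ε * volume (icyl n p lam (R / 10) 0 0))
    (h2 : ∀ (x : EuclideanSpace ℝ (Fin n)) (t : ℝ), x ∈ Ω → t < T →
      ∀ r ∈ Ioc (0 : ℝ) (R / 10),
        ENNReal.ofReal ε * volume (icyl n p lam r 0 0) ≤ volume (C ∩ icyl n p lam r x t) →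
          icyl n p lam r x t ∩ (Ω ×ˢ Iio T) ⊆ D) :
    volume C ≤ ENNReal.ofReal ((10 / (1 - δ)) ^ (n + 2) * ε) * volume D ∧
      ENNReal.ofReal ((10 / (1 - δ)) ^ (n + 2) * ε) * volume D ≤
        ENNReal.ofReal ((80 / 7) ^ (n + 2) * ε) * volume D := by
  have hδ1 : 0 < 1 - δ := by linarith [hδ.2]
  refine ⟨?_, ?_⟩
  swap
  · have h : 10 / (1 - δ) ≤ 80 / 7 := by
      rw [div_le_div_iff₀ hδ1 (by norm_num)]
      linarith [hδ.2]
    gcongr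
  have hR10 : 0 < R / 10 := by positivity
  set S : EuclideanSpace ℝ (Fin n) × ℝ → Set ℝ := fun a => {r | r ∈ Ioc 0 (R / 10) ∧
    ENNReal.ofReal ε * volume (icyl n p lam r 0 0) ≤ volume (C ∩ icyl n p lam r a.1 a.2)} with hS
  set A : Set (EuclideanSpace ℝ (Fin n) × ℝ) := {a ∈ C | (S a).Nonempty} with hA
  have hCtop : volume C ≠ ∞ := hCb.measure_lt_top.ne
  have hN : volume (C \ A) = 0 := by
    refine volume_eq_zero_of_density_le (p := p) hlam hε hε1 hR10 _
      (measure_ne_top_of_subset sdiff_subset hCtop) fun a ha r hr => ?_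
    rw [volume_icyl_center]
    by_contra! h
    exact ha.2 ⟨ha.1, r, hr, h.le.trans (by gcongr; exact sdiff_subset)⟩
  have hρ : ∀ a ∈ A, ∃ r ∈ S a, 5 * r ∉ S a := fun a ha =>
    exists_mem_five_mul_notMem (fun r hr => hr.1) ha.2
  choose! ρ hρS hρ5 using hρ
  obtain ⟨u, huA, huc, hud, hcov⟩ := exists_disjoint_icyl_covering (p := p) hlam A ρ (R / 10)
    fun a ha => (hρS a ha).1
  have hCΩ : ∀ a ∈ A, a.1 ∈ Ω ∧ a.2 < T := fun a ha => hD (hCD ha.1)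
  have hsmall : ∀ a ∈ A, volume (C ∩ icyl n p lam (5 * ρ a) a.1 a.2) ≤
      ENNReal.ofReal ε * volume (icyl n p lam (5 * ρ a) 0 0) := by
    intro a ha
    have h0 := (hρS a ha).1.1
    rcases le_or_gt (5 * ρ a) (R / 10) with h | h
    · by_contra! h'
      exact hρ5 a ha ⟨⟨by positivity, h⟩, h'.le⟩
    · calc volume (C ∩ icyl n p lam (5 * ρ a) a.1 a.2) ≤ volume C :=
            measure_mono inter_subset_left
        _ ≤ _ := h1.le
        _ ≤ _ := by gcongr; exact icyl_mono hlam hR10.le h.le 0 0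
  have hdisj : u.PairwiseDisjoint
      (fun a => icyl n p lam (ρ a) a.1 a.2 ∩ Ω ×ˢ Iio T) :=
    hud.mono fun a => inter_subset_left
  have hsum : ∑' b : u, volume (icyl n p lam (ρ b) b.1.1 b.1.2 ∩ Ω ×ˢ Iio T) ≤ volume D := by
    rw [← measure_biUnion huc hdisj fun b _ =>
      ((isOpen_icyl ..).inter (hΩo.prod isOpen_Iio)).measurableSet]
    exact measure_mono (iUnion₂_subset fun b hb =>
      h2 b.1 b.2 (hCΩ b (huA hb)).1 (hCΩ b (huA hb)).2 _ (hρS b (huA hb)).1 (hρS b (huA hb)).2)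
  have hterm : ∀ b : u, volume (C ∩ icyl n p lam (5 * ρ b) b.1.1 b.1.2) ≤
      ENNReal.ofReal ((10 / (1 - δ)) ^ (n + 2) * ε) *
        volume (icyl n p lam (ρ b) b.1.1 b.1.2 ∩ Ω ×ˢ Iio T) := by
    intro b
    have hb := huA b.2
    have hr := (hρS b hb).1
    calc volume (C ∩ icyl n p lam (5 * ρ b) b.1.1 b.1.2)
        ≤ ENNReal.ofReal ε * (ENNReal.ofReal (5 ^ (n + 2)) *
            volume (icyl n p lam (ρ b) b.1.1 b.1.2)) := by
          rw [← volume_icyl_mul (by norm_num), volume_icyl_center]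
          exact hsmall b hb
      _ ≤ ENNReal.ofReal ε * (ENNReal.ofReal (5 ^ (n + 2)) *
            (ENNReal.ofReal ((2 / (1 - δ)) ^ (n + 2)) *
              volume (icyl n p lam (ρ b) b.1.1 b.1.2 ∩ Ω ×ˢ Iio T))) := by
          gcongr
          exact hRF.volume_icyl_le hδ hΩo hlam (hCΩ b hb).1 (hCΩ b hb).2 hr.1
            (by linarith [hr.2])
      _ = _ := by
          rw [← mul_assoc, ← mul_assoc, ← ENNReal.ofReal_mul hε.le,
            ← ENNReal.ofReal_mul (by positivity), mul_assoc ε, ← mul_pow, mul_comm ε]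
          congr 4
          ring
  calc volume C ≤ volume (C \ A) + volume A := by
        rw [add_comm]
        exact (measure_mono (fun a ha => or_iff_not_imp_left.2 fun h => ⟨ha, h⟩)).trans (measure_union_le _ _)
    _ = volume A := by rw [hN, zero_add]
    _ ≤ ∑' b : u, volume (C ∩ icyl n p lam (5 * ρ b) b.1.1 b.1.2) := by
        refine (measure_mono (fun a ha => ?_)).trans (measure_biUnion_le volume huc
          fun b => C ∩ icyl n p lam (5 * ρ b) b.1 b.2)
        rw [← inter_iUnion₂]
        exact ⟨ha.1, hcov ha⟩
    _ ≤ ∑' b : u, ENNReal.ofReal ((10 / (1 - δ)) ^ (n + 2) * ε) *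
          volume (icyl n p lam (ρ b) b.1.1 b.1.2 ∩ Ω ×ˢ Iio T) := ENNReal.tsum_le_tsum hterm
    _ ≤ _ := by
        rw [ENNReal.tsum_mul_left]
        gcongr
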